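/- Let G be a simple graph (no loops or multiple edges) with n vertices and m edges, and let τ(G;x) = d₂(xIₙ − A(G)) be its second immanantal polynomial. Then (m − n)·τ(G;x) + x·τ'(G;x) = Σ_{v_s v_t ∈ E(G)} [τ(G − v_s v_t; x) + τ(G − v_s − v_t; x)], where G − v_s v_t is the graph obtained by deleting the edge v_s v_t, and G − v_s − v_t is the graph obtained by deleting both endpoints v_s and v_t (together with all incident edges). -/

import Mathlib

open Matrix Finset Polynomial

/-- The second immanant `d₂(M) = Σ_i M i i * det (M(i)) - det M`, where `M(i)` is the
submatrix of `M` obtained by deleting row `i` and column `i`. -/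
noncomputable def d2 {α : Type*} [Fintype α] [DecidableEq α] {R : Type*} [CommRing R]
    (M : Matrix α α R) : R :=
  (∑ i, M i i *
    (M.submatrix (fun k : {k : α // k ≠ i} => (k : α))
      (fun k : {k : α // k ≠ i} => (k : α))).det) - M.det

open Classical in
/-- The second immanantal polynomial `τ(G; x) = d₂(x Iₙ - A(G))` of a simple graph `G`,
where `A(G)` is the 0-1 adjacency matrix of `G`. -/
noncomputable def tau {V : Type*} [Fintype V] (G : SimpleGraph V) : Polynomial ℝ :=
  d2 (Matrix.diagonal (fun _ => (X : Polynomial ℝ)) -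
    Matrix.of (fun i j => if G.Adj i j then (1 : Polynomial ℝ) else 0))

section Helpers

variable {V : Type*}

open Classical in
/-- The matrix `x I - A(G)`. -/
noncomputable def charMat (G : SimpleGraph V) : Matrix V V (Polynomial ℝ) :=
  Matrix.diagonal (fun _ => (X : Polynomial ℝ)) -
    Matrix.of (fun i j => if G.Adj i j then (1 : Polynomial ℝ) else 0)

theorem charMat_self (G : SimpleGraph V) (i : V) : charMat G i i = X := by
  simp [charMat]

open Classical in
theorem charMat_of_ne (G : SimpleGraph V) {i j : V} (h : i ≠ j) :
    charMat G i j = -(if G.Adj i j then 1 else 0) := by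
  simp [charMat, h]

variable [Fintype V]

/-- Permutations of `α` fixing `a` are the permutations of the complement of `a`. -/
theorem sum_perm_fix {α M : Type*} [Fintype α] [DecidableEq α] [AddCommMonoid M]
    (a : α) (g : Equiv.Perm α → M) :
    ∑ τ : Equiv.Perm {k : α // k ≠ a}, g (Equiv.Perm.ofSubtype τ) =
      ∑ σ : Equiv.Perm α, if σ a = a then g σ else 0 := by
  rw [← Finset.sum_filter]
  refine Finset.sum_bij (fun τ _ => Equiv.Perm.ofSubtype τ) ?_ ?_ ?_ ?_
  · intro τ _
    simp [Equiv.Perm.ofSubtype_apply_of_not_mem]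
  · intro τ _ τ' _ h
    exact Equiv.Perm.ofSubtype_injective h
  · intro σ hσ
    have ha : σ a = a := by simpa using hσ
    refine ⟨σ.subtypePerm (p := fun k => k ≠ a) ?_, Finset.mem_univ _, ?_⟩
    · intro x
      rw [not_iff_not]
      exact ⟨fun h => σ.injective (h.trans ha.symm), fun h => by rw [h, ha]⟩
    · apply Equiv.Perm.ofSubtype_subtypePerm
      intro x hx h
      exact hx (by rw [h, ha])
  · intro _ _
    rfl

/-- The second immanant as a sum over permutations. -/
theorem d2_eq_sum_perm {α R : Type*} [Fintype α] [DecidableEq α] [CommRing R]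
    (M : Matrix α α R) :
    d2 M = ∑ σ : Equiv.Perm α,
      (((Equiv.Perm.sign σ : ℤ) * ((∑ i, if σ i = i then 1 else 0) - 1) : ℤ) : R) *
        ∏ i, M (σ i) i := by
  have key : ∀ a, M a a * (M.submatrix (fun k : {k : α // k ≠ a} => (k : α))
      (fun k : {k : α // k ≠ a} => (k : α))).det =
      ∑ σ : Equiv.Perm α, if σ a = a then
        ((Equiv.Perm.sign σ : ℤ) : R) * ∏ i, M (σ i) i else 0 := by
    intro a
    rw [← sum_perm_fix a, Matrix.det_apply', Finset.mul_sum]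
    refine Finset.sum_congr rfl fun τ _ => ?_
    rw [Fintype.prod_eq_mul_prod_subtype_ne _ a, Equiv.Perm.sign_ofSubtype,
      Equiv.Perm.ofSubtype_apply_of_not_mem τ (by simp)]
    simp only [Equiv.Perm.ofSubtype_apply_coe, Matrix.submatrix_apply]
    ring
  rw [d2, Finset.sum_congr rfl fun a _ => key a, Finset.sum_comm, Matrix.det_apply',
    ← Finset.sum_sub_distrib]
  refine Finset.sum_congr rfl fun σ _ => ?_
  rw [← Finset.sum_filter, Finset.sum_const, Finset.sum_boole, nsmul_eq_mul]
  push_cast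
  ring

open Classical in
/-- The integer coefficient of a permutation in the second immanant. -/
noncomputable def d2Coeff (σ : Equiv.Perm V) : ℤ :=
  (Equiv.Perm.sign σ : ℤ) * ((∑ i, if σ i = i then 1 else 0) - 1)

open Classical in
theorem tau_eq_sum_perm (G : SimpleGraph V) :
    tau G = ∑ σ : Equiv.Perm V, (d2Coeff σ : Polynomial ℝ) * ∏ i, charMat G (σ i) i :=
  d2_eq_sum_perm (charMat G)

open Classical in
theorem X_mul_derivative_prod_charMat (G : SimpleGraph V) (σ : Equiv.Perm V) :
    X * derivative (∏ i, charMat G (σ i) i) =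
      (∑ i, if σ i = i then 1 else 0) * ∏ i, charMat G (σ i) i := by
  rw [Polynomial.derivative_prod_finset, Finset.mul_sum, Finset.sum_mul]
  refine Finset.sum_congr rfl fun i _ => ?_
  rw [← Finset.mul_prod_erase univ _ (Finset.mem_univ i)]
  by_cases h : σ i = i
  · simp [h, charMat_self, mul_comm]
  · rw [charMat_of_ne G h]
    split_ifs <;> simp

open Classical in
theorem prod_charMat_deleteEdges (G : SimpleGraph V) {s t : V} (hst : s ≠ t)
    (σ : Equiv.Perm V) :
    ∏ i, charMat (G.deleteEdges {s(s, t)}) (σ i) i =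
      if σ s = t ∨ σ t = s then 0 else ∏ i, charMat G (σ i) i := by
  split_ifs with h
  · rcases h with h | h
    · refine Finset.prod_eq_zero (Finset.mem_univ s) ?_
      rw [h, charMat_of_ne _ hst.symm]
      simp
    · refine Finset.prod_eq_zero (Finset.mem_univ t) ?_
      rw [h, charMat_of_ne _ hst]
      simp
  · refine Finset.prod_congr rfl fun i _ => ?_
    by_cases hi : σ i = i
    · rw [hi, charMat_self, charMat_self]
    · have : s(σ i, i) ≠ s(s, t) := by
        intro h'
        rcases Sym2.eq_iff.1 h' with ⟨h1, h2⟩ | ⟨h1, h2⟩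
        · exact h (Or.inr (h2 ▸ h1))
        · exact h (Or.inl (h2 ▸ h1))
      rw [charMat_of_ne _ hi, charMat_of_ne _ hi]
      simp only [SimpleGraph.deleteEdges_adj, Set.mem_singleton_iff, this, not_false_eq_true,
        and_true]

@[to_additive]
theorem prod_eq_mul_prod_subtype_ne_ne {α M : Type*} [Fintype α] [DecidableEq α]
    [CommMonoid M] {s t : α} (hst : s ≠ t) [Fintype {k : α | k ≠ s ∧ k ≠ t}] (f : α → M) :
    ∏ i, f i = f s * f t * ∏ i : {k : α | k ≠ s ∧ k ≠ t}, f i := by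
  rw [← Finset.mul_prod_erase univ f (Finset.mem_univ s),
    ← Finset.mul_prod_erase (univ.erase s) f (a := t) (by simp [hst.symm]), mul_assoc]
  congr 2
  exact Finset.prod_subtype _ (by simp [and_comm]) f

/-- Permutations of `α` swapping `s` and `t` are the permutations of the complement of
`{s, t}`. -/
theorem sum_perm_swap {α M : Type*} [Fintype α] [DecidableEq α] [AddCommMonoid M]
    {s t : α} [Fintype (Equiv.Perm {k : α | k ≠ s ∧ k ≠ t})]
    [DecidablePred (· ∈ {k : α | k ≠ s ∧ k ≠ t})] (g : Equiv.Perm α → M) :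
    ∑ τ : Equiv.Perm {k : α | k ≠ s ∧ k ≠ t},
        g (Equiv.swap s t * Equiv.Perm.ofSubtype τ) =
      ∑ σ : Equiv.Perm α, if σ s = t ∧ σ t = s then g σ else 0 := by
  rw [← Finset.sum_filter]
  refine Finset.sum_bij (fun τ _ => Equiv.swap s t * Equiv.Perm.ofSubtype τ) ?_ ?_ ?_ ?_
  · intro τ _
    have h1 := Equiv.Perm.ofSubtype_apply_of_not_mem (a := s) τ (by simp)
    have h2 := Equiv.Perm.ofSubtype_apply_of_not_mem (a := t) τ (by simp)
    simp [h1, h2]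
  · intro τ _ τ' _ h
    exact Equiv.Perm.ofSubtype_injective (mul_left_cancel h)
  · intro σ hσ
    obtain ⟨hs, ht⟩ : σ s = t ∧ σ t = s := by simpa using hσ
    have hs' : (Equiv.swap s t * σ) s = s := by simp [hs]
    have ht' : (Equiv.swap s t * σ) t = t := by simp [ht]
    refine ⟨(Equiv.swap s t * σ).subtypePerm (p := (· ∈ {k : α | k ≠ s ∧ k ≠ t})) ?_,
      Finset.mem_univ _, ?_⟩
    · intro x
      have e : ∀ y, (Equiv.swap s t * σ) y = y →
          ((Equiv.swap s t * σ) x = y ↔ x = y) := fun y hy =>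
        ⟨fun h => (Equiv.swap s t * σ).injective (h.trans hy.symm), fun h => by rw [h, hy]⟩
      simp only [Set.mem_ofPred_eq, ne_eq, e s hs', e t ht']
    · rw [Equiv.Perm.ofSubtype_subtypePerm, ← mul_assoc, Equiv.swap_mul_self, one_mul]
      intro x hx
      refine ⟨fun h => hx (by rw [h, hs']), fun h => hx (by rw [h, ht'])⟩
  · intro _ _
    rfl

open Classical in
theorem tau_induce_compl_edge (G : SimpleGraph V) {s t : V} (hst : G.Adj s t)
    [Fintype {k : V | k ≠ s ∧ k ≠ t}] :
    tau (G.induce {k : V | k ≠ s ∧ k ≠ t}) =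
      ∑ σ : Equiv.Perm V, if σ s = t ∧ σ t = s then
        -((d2Coeff σ : Polynomial ℝ) * ∏ i, charMat G (σ i) i) else 0 := by
  rw [← sum_perm_swap, tau_eq_sum_perm]
  refine Finset.sum_congr (Finset.ext (by simp)) fun τ _ => ?_
  have h1 : Equiv.Perm.ofSubtype τ s = s :=
    Equiv.Perm.ofSubtype_apply_of_not_mem (a := s) τ (by simp)
  have h2 : Equiv.Perm.ofSubtype τ t = t :=
    Equiv.Perm.ofSubtype_apply_of_not_mem (a := t) τ (by simp)
  have h3 : ∀ i : {k : V | k ≠ s ∧ k ≠ t},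
      (Equiv.swap s t * Equiv.Perm.ofSubtype τ) i = τ i := by
    intro i
    rw [Equiv.Perm.mul_apply, Equiv.Perm.ofSubtype_apply_coe]
    exact Equiv.swap_apply_of_ne_of_ne (τ i).2.1 (τ i).2.2
  have h4 : (∑ i : {k : V | k ≠ s ∧ k ≠ t},
      if (Equiv.swap s t * Equiv.Perm.ofSubtype τ) i = i then (1 : ℤ) else 0) =
      ∑ i, if τ i = i then 1 else 0 :=
    Finset.sum_congr rfl fun i _ => if_congr (by rw [h3, Subtype.ext_iff]) rfl rfl
  have hc : d2Coeff (Equiv.swap s t * Equiv.Perm.ofSubtype τ) = -d2Coeff τ := by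
    rw [d2Coeff, d2Coeff, sum_eq_add_sum_subtype_ne_ne hst.ne, h4, Equiv.Perm.sign_mul,
      Equiv.Perm.sign_swap hst.ne, Equiv.Perm.sign_ofSubtype]
    simp only [Equiv.Perm.mul_apply, h1, h2, Equiv.swap_apply_left,
      Equiv.swap_apply_right, hst.ne, hst.ne.symm, if_false]
    rw [zero_add, zero_add, neg_mul, one_mul, Units.val_neg, neg_mul]
    congr!
  have hm : ∀ i j : {k : V | k ≠ s ∧ k ≠ t},
      charMat (G.induce {k : V | k ≠ s ∧ k ≠ t}) i j = charMat G i j := by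
    intro i j
    by_cases hij : i = j
    · rw [hij, charMat_self, charMat_self]
    · rw [charMat_of_ne _ hij, charMat_of_ne _ (fun h => hij (Subtype.ext h))]
      simp
  rw [hc, prod_eq_mul_prod_subtype_ne_ne hst.ne]
  simp only [h3, hm, Equiv.Perm.mul_apply, h1, h2, Equiv.swap_apply_left,
    Equiv.swap_apply_right, charMat_of_ne G hst.ne, charMat_of_ne G hst.ne.symm, hst,
    hst.symm, if_true]
  push_cast
  ring

open Classical in
/-- The contribution of a single edge, as a sum over permutations. -/
theorem tau_deleteEdges_add_tau_induce (G : SimpleGraph V) {s t : V} (hst : G.Adj s t)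
    [Fintype {k : V | k ≠ s ∧ k ≠ t}] :
    tau (G.deleteEdges {s(s, t)}) + tau (G.induce {k : V | k ≠ s ∧ k ≠ t}) =
      ∑ σ : Equiv.Perm V, (d2Coeff σ : Polynomial ℝ) * (∏ i, charMat G (σ i) i) *
        (1 - ((if σ s = t then 1 else 0) + if σ t = s then 1 else 0)) := by
  rw [tau_induce_compl_edge G hst, tau_eq_sum_perm, ← Finset.sum_add_distrib]
  refine Finset.sum_congr rfl fun σ _ => ?_
  rw [prod_charMat_deleteEdges G hst.ne]
  by_cases h1 : σ s = t <;> by_cases h2 : σ t = s <;> simp [h1, h2]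

open Classical in
/-- A permutation with nonzero weight moves every non-fixed point along an edge. -/
theorem prod_charMat_mul_sum_adj (G : SimpleGraph V) (σ : Equiv.Perm V) :
    (∏ i, charMat G (σ i) i) *
        ∑ i, ∑ j, (if G.Adj i j then (if σ i = j then (1 : Polynomial ℝ) else 0) else 0) =
      (∏ i, charMat G (σ i) i) *
        ((Fintype.card V : Polynomial ℝ) - ∑ i, if σ i = i then 1 else 0) := by
  by_cases hP : ∏ i, charMat G (σ i) i = 0
  · rw [hP, zero_mul, zero_mul]
  congr 1
  rw [eq_sub_iff_add_eq, ← Finset.sum_add_distrib, ← nsmul_one, Fintype.card,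
    ← Finset.sum_const]
  refine Finset.sum_congr rfl fun i _ => ?_
  have hi : charMat G (σ i) i ≠ 0 := fun h => hP (Finset.prod_eq_zero (Finset.mem_univ i) h)
  rw [Finset.sum_eq_single (σ i) (by intro j _ hj; simp [hj.symm]) (by simp)]
  by_cases h : σ i = i
  · simp [h]
  · rw [charMat_of_ne G h] at hi
    have hadj : G.Adj i (σ i) := by
      by_contra h'
      exact hi (by simp [G.adj_comm, h'])
    simp [h, hadj]

theorem sum_lt_adj_add_swap {α M : Type*} [Fintype α] [LinearOrder α] [AddCommMonoid M]
    (G : SimpleGraph α) [DecidableRel G.Adj]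
    [DecidablePred fun p : α × α => p.1 < p.2 ∧ G.Adj p.1 p.2] (f : α → α → M) :
    ∑ p ∈ univ.filter (fun p : α × α => p.1 < p.2 ∧ G.Adj p.1 p.2),
        (f p.1 p.2 + f p.2 p.1) =
      ∑ i, ∑ j, if G.Adj i j then f i j else 0 := by
  have h : ∑ p ∈ univ.filter (fun p : α × α => p.1 < p.2 ∧ G.Adj p.1 p.2), f p.2 p.1 =
      ∑ p ∈ univ.filter (fun p : α × α => p.2 < p.1 ∧ G.Adj p.1 p.2), f p.1 p.2 :=
    Finset.sum_bij' (fun p _ => p.swap) (fun p _ => p.swap)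
      (by simp [G.adj_comm]) (by simp [G.adj_comm]) (by simp) (by simp) (by simp)
  rw [Finset.sum_add_distrib, h, Finset.sum_filter, Finset.sum_filter,
    ← Finset.sum_add_distrib, Fintype.sum_prod_type]
  refine Finset.sum_congr rfl fun i _ => Finset.sum_congr rfl fun j _ => ?_
  by_cases hij : G.Adj i j
  · rcases lt_or_gt_of_ne hij.ne with h | h <;> simp [hij, h, h.not_gt]
  · simp [hij]

theorem card_edgeFinset_eq_card_lt_adj {α : Type*} [Fintype α] [LinearOrder α]
    (G : SimpleGraph α) [Fintype G.edgeSet]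
    [DecidablePred fun p : α × α => p.1 < p.2 ∧ G.Adj p.1 p.2] :
    G.edgeFinset.card =
      (univ.filter (fun p : α × α => p.1 < p.2 ∧ G.Adj p.1 p.2)).card := by
  symm
  refine Finset.card_bij (fun p _ => s(p.1, p.2)) ?_ ?_ ?_
  · intro p hp
    simpa using (Finset.mem_filter.1 hp).2.2
  · intro p hp q hq h
    have hp := (Finset.mem_filter.1 hp).2.1
    have hq := (Finset.mem_filter.1 hq).2.1
    rcases Sym2.eq_iff.1 h with ⟨h1, h2⟩ | ⟨h1, h2⟩
    · exact Prod.ext h1 h2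
    · rw [h1, h2] at hp
      exact absurd hp hq.not_gt
  · intro e he
    induction e using Sym2.ind with
    | _ a b =>
      have hab : G.Adj a b := by simpa using he
      rcases lt_or_gt_of_ne hab.ne with h | h
      · exact ⟨(a, b), by simp [h, hab], rfl⟩
      · exact ⟨(b, a), by simp [h, hab.symm], Sym2.eq_swap⟩

end Helpers

open Classical in
/-- Let `G` be a simple graph with `n` vertices and `m` edges, and
`τ(G;x) = d₂(x Iₙ - A(G))` its second immanantal polynomial. Then
`(m - n) τ(G;x) + x τ'(G;x) = Σ_{v_s v_t ∈ E(G)} [τ(G - v_s v_t; x) + τ(G - v_s - v_t; x)]`,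
where `G - v_s v_t` deletes the edge `v_s v_t` and `G - v_s - v_t` deletes both endpoints
(together with all incident edges); the sum over edges is written as a sum over pairs
`(s, t)` with `s < t` and `G.Adj s t`. -/
theorem edge_sum_tau {n m : ℕ} (G : SimpleGraph (Fin n)) (hm : G.edgeFinset.card = m) :
    ((m : Polynomial ℝ) - (n : Polynomial ℝ)) * tau G + X * Polynomial.derivative (tau G)
      = ∑ p ∈ Finset.univ.filter (fun p : Fin n × Fin n => p.1 < p.2 ∧ G.Adj p.1 p.2),
          (tau (G.deleteEdges {s(p.1, p.2)}) +
            tau (G.induce {k : Fin n | k ≠ p.1 ∧ k ≠ p.2})) := by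
  rw [Finset.sum_congr rfl fun p hp =>
    tau_deleteEdges_add_tau_induce G (Finset.mem_filter.1 hp).2.2, Finset.sum_comm,
    tau_eq_sum_perm, Polynomial.derivative_sum, Finset.mul_sum, Finset.mul_sum,
    ← Finset.sum_add_distrib]
  refine Finset.sum_congr rfl fun σ _ => ?_
  have h := prod_charMat_mul_sum_adj G σ
  rw [← Finset.mul_sum, Finset.sum_sub_distrib,
    sum_lt_adj_add_swap G 
      (fun i j => @ite _ (σ i = j) (Classical.propDecidable _) (1 : Polynomial ℝ) 0),
    Finset.sum_const, nsmul_one, ← card_edgeFinset_eq_card_lt_adj, hm,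
    Polynomial.derivative_intCast_mul]
  have h' := X_mul_derivative_prod_charMat G σ
  rw [Fintype.card_fin] at h
  linear_combination (d2Coeff σ : Polynomial ℝ) * h' + (d2Coeff σ : Polynomial ℝ) * h
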